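/- Let d = 2^ℓ, let ε, δ ∈ (0, 1/2), and let 𝒲 ⊂ ℝ^d be bounded with diameter Diam(𝒲). Let b^j_k, j ∈ [m], k ∈ [d], be i.i.d. uniform on [0, 2π], independent of the diagonal matrices. There are absolute constants C, c > 0 such that if m ≥ C ε⁻² (1 + Diam(𝒲))² log^c(d(1 + Diam(𝒲))/(εδ)), then with probability at least 1 − δ/2, for all x, y ∈ 𝒲, (1/(md))·|Σ_{j=1}^m Σ_{k=1}^d cos(h̃_{j,k}(x + y) + 2b^j_k)| ≤ ε/8. -/

import Mathlib

open MeasureTheory ProbabilityTheory Real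
open scoped ENNReal NNReal Classical

noncomputable section

/-- The Sylvester–Hadamard matrix of size `2^ℓ`: `H 0 = [1]`,
`H (ℓ+1) = [[H ℓ, H ℓ],[H ℓ, -H ℓ]]`. -/
def Had : ∀ ℓ : ℕ, Matrix (Fin (2 ^ ℓ)) (Fin (2 ^ ℓ)) ℝ
  | 0 => 1
  | (ℓ + 1) =>
      Matrix.reindex (finSumFinEquiv.trans (finCongr (by rw [pow_succ, mul_two])))
        (finSumFinEquiv.trans (finCongr (by rw [pow_succ, mul_two])))
        (Matrix.fromBlocks (Had ℓ) (Had ℓ) (Had ℓ) (-(Had ℓ)))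

/-- `rht ℓ m D z j k = (H_d D^j z)_k`, the `(j,k)` entry of the randomized Hadamard
transform of `z`, where `D j` records the diagonal entries of the diagonal matrix `D^j`. -/
def rht (ℓ m : ℕ) (D : Fin m → Fin (2 ^ ℓ) → ℝ) (z : EuclideanSpace ℝ (Fin (2 ^ ℓ)))
    (j : Fin m) (k : Fin (2 ^ ℓ)) : ℝ :=
  (Had ℓ).mulVec (fun i => D j i * z i) k

/-- The joint law of the diagonal entries of `D^1, …, D^m`: i.i.d. standard Gaussians. -/
def diagMeasure (ℓ m : ℕ) : Measure (Fin m → Fin (2 ^ ℓ) → ℝ) :=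
  Measure.pi fun _ => Measure.pi fun _ => gaussianReal 0 1

/-- The joint law of the phases `b^j_k`: i.i.d. uniform on `[0, 2π]`. -/
def phaseMeasure (ℓ m : ℕ) : Measure (Fin m → Fin (2 ^ ℓ) → ℝ) :=
  Measure.pi fun _ => Measure.pi fun _ =>
    (ENNReal.ofReal (2 * Real.pi))⁻¹ • volume.restrict (Set.Icc (0 : ℝ) (2 * Real.pi))

/-- The uniform law of a single phase on `[0, 2π]`. -/
def phaseLaw : Measure ℝ :=
  (ENNReal.ofReal (2 * Real.pi))⁻¹ • volume.restrict (Set.Icc (0 : ℝ) (2 * Real.pi))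

instance isProbabilityMeasure_phaseLaw : IsProbabilityMeasure phaseLaw := by
  constructor
  have hpos : ENNReal.ofReal (2 * Real.pi) ≠ 0 := by
    simpa using Real.pi_pos
  simp only [phaseLaw, Measure.smul_apply, Measure.restrict_apply_univ, Real.volume_Icc, sub_zero,
    smul_eq_mul]
  exact ENNReal.inv_mul_cancel hpos ENNReal.ofReal_ne_top

instance isProbabilityMeasure_diagMeasure (ℓ m : ℕ) : IsProbabilityMeasure (diagMeasure ℓ m) := by
  unfold diagMeasure
  infer_instance

lemma phaseMeasure_eq_pi (ℓ m : ℕ) :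
    phaseMeasure ℓ m = Measure.pi fun _ => Measure.pi fun _ => phaseLaw := rfl

instance isProbabilityMeasure_phaseMeasure (ℓ m : ℕ) :
    IsProbabilityMeasure (phaseMeasure ℓ m) := by
  rw [phaseMeasure_eq_pi]
  infer_instance

lemma integral_cos_add_two_mul_phaseLaw (a : ℝ) :
    ∫ b, Real.cos (a + 2 * b) ∂phaseLaw = 0 := by
  have h : ∫ b in (0 : ℝ)..(2 * Real.pi), Real.cos (a + 2 * b) = 0 := by
    rw [intervalIntegral.integral_comp_add_mul (fun x => Real.cos x) two_ne_zero, integral_cos]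
    have : a + 2 * (2 * Real.pi) = a + 2 * Real.pi + 2 * Real.pi := by ring
    rw [this, Real.sin_add_two_pi, Real.sin_add_two_pi]
    simp
  rw [phaseLaw, integral_smul_measure, integral_Icc_eq_integral_Ioc,
    ← intervalIntegral.integral_of_le (by positivity), h, smul_zero]

lemma hasSubgaussianMGF_cos_phaseLaw (a : ℝ) :
    HasSubgaussianMGF (fun b => Real.cos (a + 2 * b)) 1 phaseLaw := by
  have h := hasSubgaussianMGF_of_mem_Icc_of_integral_eq_zero (μ := phaseLaw)
    (X := fun b => Real.cos (a + 2 * b)) (a := -1) (b := 1) (by fun_prop)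
    (ae_of_all _ fun b => ⟨Real.neg_one_le_cos _, Real.cos_le_one _⟩)
    (integral_cos_add_two_mul_phaseLaw a)
  have hc : (‖(1 : ℝ) - -1‖₊ / 2) ^ 2 = 1 := by
    have : ‖(1 : ℝ) - -1‖₊ = 2 := by
      ext
      norm_num
    rw [this]
    norm_num
  rwa [hc] at h

lemma hasSubgaussianMGF_sum_pi {ι Ω : Type*} [Fintype ι] [MeasurableSpace Ω] {μ : Measure Ω}
    [IsProbabilityMeasure μ] {X : ι → Ω → ℝ} {c : ℝ≥0} (h : ∀ i, HasSubgaussianMGF (X i) c μ) :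
    HasSubgaussianMGF (fun ω : ι → Ω => ∑ i, X i (ω i)) (Fintype.card ι * c)
      (Measure.pi fun _ => μ) := by
  have hind : iIndepFun (fun i (ω : ι → Ω) => X i (ω i)) (Measure.pi fun _ => μ) :=
    iIndepFun_pi fun i => (h i).aemeasurable
  have hsub : ∀ i ∈ Finset.univ,
      HasSubgaussianMGF (fun ω : ι → Ω => X i (ω i)) c (Measure.pi fun _ => μ) := by
    intro i _
    have hmp := measurePreserving_eval (fun _ : ι => μ) i
    refine HasSubgaussianMGF.of_map (Y := Function.eval i) hmp.measurable.aemeasurable ?_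
    rw [hmp.map_eq]
    exact h i
  simpa using HasSubgaussianMGF.sum_of_iIndepFun hind (c := fun _ => c) hsub

lemma hasSubgaussianMGF_sum_cos (ℓ m : ℕ) (a : Fin m → Fin (2 ^ ℓ) → ℝ) :
    HasSubgaussianMGF (fun b : Fin m → Fin (2 ^ ℓ) → ℝ => ∑ j, ∑ k, Real.cos (a j k + 2 * b j k))
      (m * 2 ^ ℓ) (phaseMeasure ℓ m) := by
  rw [phaseMeasure_eq_pi]
  simpa using hasSubgaussianMGF_sum_pi
    (X := fun j (b : Fin (2 ^ ℓ) → ℝ) => ∑ k, Real.cos (a j k + 2 * b k))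
    fun j => hasSubgaussianMGF_sum_pi fun k => hasSubgaussianMGF_cos_phaseLaw (a j k)

lemma phaseMeasure_abs_sum_cos_ge_le (ℓ m : ℕ) (a : Fin m → Fin (2 ^ ℓ) → ℝ) {t : ℝ}
    (ht : 0 ≤ t) :
    phaseMeasure ℓ m {b | t ≤ |∑ j, ∑ k, Real.cos (a j k + 2 * b j k)|} ≤
      ENNReal.ofReal (2 * Real.exp (-t ^ 2 / (2 * (m * 2 ^ ℓ)))) := by
  have h := hasSubgaussianMGF_sum_cos ℓ m a
  have hpos := h.measure_ge_le ht
  have hneg := h.neg.measure_ge_le ht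
  push_cast at hpos hneg
  rw [← ofReal_measureReal]
  refine ENNReal.ofReal_le_ofReal ?_
  rw [two_mul (Real.exp _)]
  refine (measureReal_mono ?_).trans
    ((measureReal_union_le _ _).trans (add_le_add hpos hneg))
  intro b hb
  simpa [le_abs] using hb

lemma measurable_rht (ℓ m : ℕ) (z : EuclideanSpace ℝ (Fin (2 ^ ℓ))) (j : Fin m)
    (k : Fin (2 ^ ℓ)) : Measurable fun D => rht ℓ m D z j k := by
  unfold rht Matrix.mulVec dotProduct
  fun_prop

lemma prod_abs_sum_cos_rht_ge_le (ℓ m : ℕ) (z : EuclideanSpace ℝ (Fin (2 ^ ℓ))) {t : ℝ}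
    (ht : 0 ≤ t) :
    ((diagMeasure ℓ m).prod (phaseMeasure ℓ m))
        {p | t ≤ |∑ j, ∑ k, Real.cos (rht ℓ m p.1 z j k + 2 * p.2 j k)|} ≤
      ENNReal.ofReal (2 * Real.exp (-t ^ 2 / (2 * (m * 2 ^ ℓ)))) := by
  have hmeas : MeasurableSet {p : (Fin m → Fin (2 ^ ℓ) → ℝ) × (Fin m → Fin (2 ^ ℓ) → ℝ) |
      t ≤ |∑ j, ∑ k, Real.cos (rht ℓ m p.1 z j k + 2 * p.2 j k)|} := by
    refine measurableSet_le measurable_const ?_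
    have hrht (j : Fin m) (k : Fin (2 ^ ℓ)) :
        Measurable fun p : (Fin m → Fin (2 ^ ℓ) → ℝ) × (Fin m → Fin (2 ^ ℓ) → ℝ) =>
          rht ℓ m p.1 z j k := (measurable_rht ℓ m z j k).comp measurable_fst
    fun_prop
  rw [Measure.prod_apply hmeas]
  refine (lintegral_mono fun D =>
    phaseMeasure_abs_sum_cos_ge_le ℓ m (fun j k => rht ℓ m D z j k) ht).trans ?_
  simp

lemma lintegral_ofReal_abs_gaussianReal_le :
    ∫⁻ x, ENNReal.ofReal |x| ∂gaussianReal 0 1 ≤ 1 := by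
  have hsq : Integrable (fun x : ℝ => x ^ 2) (gaussianReal 0 1) :=
    (memLp_id_gaussianReal 2).integrable_sq
  have hint : ∫ x, x ^ 2 ∂gaussianReal 0 1 = 1 := by
    have h := variance_fun_id_gaussianReal (μ := 0) (v := 1)
    rw [variance_eq_integral measurable_id'.aemeasurable] at h
    simpa using h
  calc ∫⁻ x, ENNReal.ofReal |x| ∂gaussianReal 0 1
      ≤ ∫⁻ x, ENNReal.ofReal ((1 + x ^ 2) / 2) ∂gaussianReal 0 1 := by
        refine lintegral_mono fun x => ENNReal.ofReal_le_ofReal ?_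
        nlinarith [sq_nonneg (|x| - 1), sq_abs x]
    _ = ENNReal.ofReal (∫ x, (1 + x ^ 2) / 2 ∂gaussianReal 0 1) :=
        (ofReal_integral_eq_lintegral_ofReal (((integrable_const 1).add hsq).div_const 2)
          (ae_of_all _ fun x => div_nonneg (add_nonneg zero_le_one (sq_nonneg x)) zero_le_two)).symm
    _ = 1 := by
        rw [integral_div, integral_add (integrable_const 1) hsq, hint]
        simp

lemma lintegral_sum_abs_diagMeasure_le (ℓ m : ℕ) :
    ∫⁻ D, ∑ j, ∑ i, ENNReal.ofReal |D j i| ∂diagMeasure ℓ m ≤ m * 2 ^ ℓ := by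
  have hentry (j : Fin m) (i : Fin (2 ^ ℓ)) :
      ∫⁻ D, ENNReal.ofReal |D j i| ∂diagMeasure ℓ m ≤ 1 := by
    have hmp : MeasurePreserving (fun D : Fin m → Fin (2 ^ ℓ) → ℝ => D j i) (diagMeasure ℓ m)
        (gaussianReal 0 1) :=
      (measurePreserving_eval (fun _ : Fin (2 ^ ℓ) => gaussianReal 0 1) i).comp
        (measurePreserving_eval
          (fun _ : Fin m => Measure.pi fun _ : Fin (2 ^ ℓ) => gaussianReal 0 1) j)
    rw [hmp.lintegral_comp (f := fun x => ENNReal.ofReal |x|) (by fun_prop)]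
    exact lintegral_ofReal_abs_gaussianReal_le
  rw [lintegral_finsetSum _ fun j _ => by fun_prop]
  simp_rw [fun j : Fin m => lintegral_finsetSum (μ := diagMeasure ℓ m) Finset.univ
    (f := fun (i : Fin (2 ^ ℓ)) (D : Fin m → Fin (2 ^ ℓ) → ℝ) => ENNReal.ofReal |D j i|)
    fun i _ => by fun_prop]
  refine (Finset.sum_le_sum fun j _ => Finset.sum_le_sum fun i _ => hentry j i).trans ?_
  simp

lemma diagMeasure_sum_abs_ge_le (ℓ m : ℕ) (hm : 0 < m) {δ : ℝ} (hδ : 0 < δ) :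
    diagMeasure ℓ m {D | 4 * (m * 2 ^ ℓ) / δ ≤ ∑ j, ∑ i, |D j i|} ≤ ENNReal.ofReal (δ / 4) := by
  have hm' : (0 : ℝ) < m := by exact_mod_cast hm
  have hT : 0 < 4 * (m * 2 ^ ℓ) / δ := by positivity
  have hset : {D : Fin m → Fin (2 ^ ℓ) → ℝ | 4 * (m * 2 ^ ℓ) / δ ≤ ∑ j, ∑ i, |D j i|} ⊆
      {D | ENNReal.ofReal (4 * (m * 2 ^ ℓ) / δ) ≤ ∑ j, ∑ i, ENNReal.ofReal |D j i|} := by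
    intro D hD
    have hsum : ∑ j, ∑ i, ENNReal.ofReal |D j i| = ENNReal.ofReal (∑ j, ∑ i, |D j i|) := by
      rw [ENNReal.ofReal_sum_of_nonneg fun j _ => Finset.sum_nonneg fun i _ => abs_nonneg _]
      exact Finset.sum_congr rfl fun j _ =>
        (ENNReal.ofReal_sum_of_nonneg fun i _ => abs_nonneg _).symm
    rw [Set.mem_ofPred_eq, hsum]
    exact ENNReal.ofReal_le_ofReal hD
  refine (measure_mono hset).trans ((meas_ge_le_lintegral_div
    (Measurable.aemeasurable (by fun_prop)) (by simpa using hT) ENNReal.ofReal_ne_top).trans ?_)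
  refine (ENNReal.div_le_div_right (lintegral_sum_abs_diagMeasure_le ℓ m) _).trans ?_
  have hcast : (m : ℝ≥0∞) * 2 ^ ℓ = ENNReal.ofReal (m * 2 ^ ℓ) := by
    rw [ENNReal.ofReal_mul (by positivity), ENNReal.ofReal_pow (by positivity)]
    simp
  rw [hcast, ← ENNReal.ofReal_div_of_pos hT]
  refine ENNReal.ofReal_le_ofReal (le_of_eq ?_)
  field_simp

lemma abs_Had_le_one : ∀ (ℓ : ℕ) (i k : Fin (2 ^ ℓ)), |Had ℓ i k| ≤ 1
  | 0, i, k => by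
      rw [Had, Matrix.one_apply]
      split_ifs <;> simp
  | ℓ + 1, i, k => by
      rw [Had, Matrix.reindex_apply, Matrix.submatrix_apply]
      generalize (finSumFinEquiv.trans (finCongr _)).symm i = p
      generalize (finSumFinEquiv.trans (finCongr _)).symm k = q
      rcases p with p | p <;> rcases q with q | q <;> simp [abs_Had_le_one ℓ]

lemma abs_rht_sub_le (ℓ m : ℕ) (D : Fin m → Fin (2 ^ ℓ) → ℝ)
    {z w : EuclideanSpace ℝ (Fin (2 ^ ℓ))} {η : ℝ} (h : ∀ i, |z i - w i| ≤ η) (j : Fin m)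
    (k : Fin (2 ^ ℓ)) : |rht ℓ m D z j k - rht ℓ m D w j k| ≤ η * ∑ i, |D j i| := by
  simp only [rht, Matrix.mulVec, dotProduct]
  rw [← Finset.sum_sub_distrib, Finset.mul_sum]
  refine (Finset.abs_sum_le_sum_abs _ _).trans (Finset.sum_le_sum fun i _ => ?_)
  have hfac : Had ℓ k i * (D j i * z i) - Had ℓ k i * (D j i * w i) =
      Had ℓ k i * ((z i - w i) * D j i) := by ring
  rw [hfac, abs_mul, abs_mul]
  calc |Had ℓ k i| * (|z i - w i| * |D j i|) ≤ 1 * (η * |D j i|) := by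
        gcongr
        · exact abs_Had_le_one ℓ k i
        · exact h i
    _ = η * |D j i| := one_mul _

lemma abs_sum_cos_rht_le (ℓ m : ℕ) (D b : Fin m → Fin (2 ^ ℓ) → ℝ)
    {z w : EuclideanSpace ℝ (Fin (2 ^ ℓ))} {η : ℝ} (h : ∀ i, |z i - w i| ≤ η) :
    |∑ j, ∑ k, Real.cos (rht ℓ m D z j k + 2 * b j k)| ≤
      |∑ j, ∑ k, Real.cos (rht ℓ m D w j k + 2 * b j k)| +
        2 ^ ℓ * (η * ∑ j, ∑ i, |D j i|) := by
  rw [← sub_le_iff_le_add']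
  refine (abs_sub_abs_le_abs_sub _ _).trans ?_
  rw [← Finset.sum_sub_distrib, Finset.mul_sum, Finset.mul_sum]
  refine (Finset.abs_sum_le_sum_abs _ _).trans (Finset.sum_le_sum fun j _ => ?_)
  rw [← Finset.sum_sub_distrib]
  refine (Finset.abs_sum_le_sum_abs _ _).trans ?_
  refine (Finset.sum_le_card_nsmul _ _ (η * ∑ i, |D j i|) fun k _ => ?_).trans
    (le_of_eq (by simp))
  refine (Real.abs_cos_sub_cos_le _ _).trans ?_
  rw [add_sub_add_right_eq_sub]
  exact abs_rht_sub_le ℓ m D h j k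

/-- A grid of mesh `η` around `c` covers, up to `η` in every coordinate, the cube of half-side `r`
centred at `c`, with at most `2 r / η + 3` points per coordinate. -/
lemma exists_grid {n : ℕ} (c : EuclideanSpace ℝ (Fin n)) {r η : ℝ} (hr : 0 ≤ r) (hη : 0 < η) :
    ∃ N : Finset (EuclideanSpace ℝ (Fin n)), (N.card : ℝ) ≤ (2 * (r / η) + 3) ^ n ∧
      ∀ z : EuclideanSpace ℝ (Fin n), (∀ i, |z i - c i| ≤ r) →
        ∃ w ∈ N, ∀ i, |z i - w i| ≤ η := by
  set M : ℕ := ⌈r / η⌉₊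
  have hM : r / η ≤ M := Nat.le_ceil _
  have hM' : (M : ℝ) ≤ r / η + 1 := (Nat.ceil_lt_add_one (by positivity)).le
  refine ⟨(Fintype.piFinset fun _ : Fin n => Finset.Icc (-(M : ℤ)) M).image
    fun v => WithLp.toLp 2 fun i => c i + η * v i, ?_, ?_⟩
  · have hcard : ((Fintype.piFinset fun _ : Fin n => Finset.Icc (-(M : ℤ)) M).card : ℝ) =
        (2 * M + 1) ^ n := by
      rw [Fintype.card_piFinset]
      simp only [Int.card_Icc, Finset.prod_const, Finset.card_univ, Fintype.card_fin]
      have : ((M : ℤ) + 1 - -(M : ℤ)).toNat = 2 * M + 1 := by omega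
      rw [this]
      push_cast
      rfl
    refine (Nat.cast_le.mpr Finset.card_image_le).trans ?_
    rw [hcard]
    refine pow_le_pow_left₀ (by positivity) ?_ n
    linarith
  · intro z hz
    refine ⟨_, Finset.mem_image_of_mem _ (a := fun i => ⌊(z i - c i) / η⌋) ?_, fun i => ?_⟩
    · rw [Fintype.mem_piFinset]
      intro i
      have hi := abs_le.mp (hz i)
      rw [Finset.mem_Icc]
      constructor
      · rw [Int.le_floor]
        push_cast
        rw [le_div_iff₀ hη]
        rw [div_le_iff₀ hη] at hM
        linarith
      · have hle : (⌊(z i - c i) / η⌋ : ℝ) ≤ (M : ℤ) := by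
          refine (Int.floor_le _).trans (le_trans ?_ (by exact_mod_cast hM))
          gcongr
          exact hi.2
        exact_mod_cast hle
    · have h1 := Int.floor_le ((z i - c i) / η)
      have h2 := Int.lt_floor_add_one ((z i - c i) / η)
      rw [le_div_iff₀ hη] at h1
      rw [div_lt_iff₀ hη] at h2
      simp only
      rw [abs_le]
      constructor <;> nlinarith

/-- The union bound over the grid beats the failure probability once `m ε²` exceeds a multiple of
`log L`. -/
lemma pow_mul_exp_le {d : ℕ} (hd : 0 < d) {K L δ s : ℝ} (hL : 4 ≤ L) (hK0 : 0 ≤ K)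
    (hK : K ≤ 256 * L) (hδ : 0 < δ) (hδL : δ⁻¹ ≤ L) (hs : 8 * Real.log L * d ≤ s) :
    K ^ d * (2 * Real.exp (-s)) ≤ δ / 4 := by
  have hL0 : 0 < L := by linarith
  have hlog : 0 ≤ Real.log L := Real.log_nonneg (by linarith)
  have hd1 : (1 : ℝ) ≤ d := by exact_mod_cast hd
  have hKL : K ≤ Real.exp (5 * Real.log L) := by
    have : Real.exp (5 * Real.log L) = L ^ 5 := by
      rw [← Real.exp_log (pow_pos hL0 5), Real.log_pow]
      norm_num
    rw [this]
    have h4 : (4 : ℝ) ^ 4 ≤ L ^ 4 := by gcongr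
    nlinarith
  have hpow : K ^ d ≤ Real.exp (d * (5 * Real.log L)) := by
    rw [Real.exp_nat_mul]
    gcongr
  have hcube : Real.exp (-(3 * Real.log L)) = (L ^ 3)⁻¹ := by
    rw [Real.exp_neg, ← Real.exp_log (pow_pos hL0 3), Real.log_pow]
    norm_num
  calc K ^ d * (2 * Real.exp (-s))
      ≤ Real.exp (d * (5 * Real.log L)) * (2 * Real.exp (-s)) := by gcongr
    _ = 2 * Real.exp (d * (5 * Real.log L) - s) := by
        rw [sub_eq_add_neg, Real.exp_add]
        ring
    _ ≤ 2 * Real.exp (-(3 * Real.log L)) := by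
        gcongr
        nlinarith
    _ = 2 * (L ^ 3)⁻¹ := by rw [hcube]
    _ ≤ δ / 4 := by
        have h1 : 1 ≤ L * δ := by
          rw [inv_le_iff_one_le_mul₀ hδ] at hδL
          linarith
        rw [← div_eq_mul_inv, div_le_iff₀ (by positivity)]
        have h2 : (4 : ℝ) ^ 2 ≤ L ^ 2 := by gcongr
        nlinarith

lemma ofReal_one_sub_le_of_compl_le {Ω : Type*} [MeasurableSpace Ω] {μ : Measure Ω}
    [IsProbabilityMeasure μ] {s : Set Ω} {r : ℝ} (hr : 0 ≤ r) (h : μ sᶜ ≤ ENNReal.ofReal r) :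
    ENNReal.ofReal (1 - r) ≤ μ s := by
  rw [ENNReal.ofReal_sub _ hr, ENNReal.ofReal_one, tsub_le_iff_right]
  calc (1 : ℝ≥0∞) = μ (s ∪ sᶜ) := by rw [Set.union_compl_self, measure_univ]
    _ ≤ μ s + μ sᶜ := measure_union_le _ _
    _ ≤ μ s + ENNReal.ofReal r := by gcongr

lemma four_le_and_inv_le {d R ε δ : ℝ} (hd : 1 ≤ d) (hR : 0 ≤ R) (hε : ε ∈ Set.Ioo (0 : ℝ) (1 / 2))
    (hδ : δ ∈ Set.Ioo (0 : ℝ) (1 / 2)) :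
    4 ≤ d * (1 + R) / (ε * δ) ∧ δ⁻¹ ≤ d * (1 + R) / (ε * δ) := by
  obtain ⟨hε0, hε1⟩ := hε
  obtain ⟨hδ0, hδ1⟩ := hδ
  have hdR : 1 ≤ d * (1 + R) := by nlinarith
  constructor
  · rw [le_div_iff₀ (by positivity)]
    nlinarith
  · rw [inv_eq_one_div, div_le_div_iff₀ hδ0 (by positivity)]
    nlinarith

/-- Lemma 4.1: the phase-shifted cosine term is uniformly small. -/
theorem cos_decomposition_first_term :
    ∃ C : ℝ, 0 < C ∧ ∃ c : ℕ, 0 < c ∧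
      ∀ (ℓ : ℕ) (ε δ : ℝ), ε ∈ Set.Ioo (0 : ℝ) (1 / 2) → δ ∈ Set.Ioo (0 : ℝ) (1 / 2) →
        ∀ W : Set (EuclideanSpace ℝ (Fin (2 ^ ℓ))), Bornology.IsBounded W →
          ∀ m : ℕ,
            C * ε⁻¹ ^ 2 * (1 + Metric.diam W) ^ 2 *
                Real.log (2 ^ ℓ * (1 + Metric.diam W) / (ε * δ)) ^ c ≤ (m : ℝ) →
            ENNReal.ofReal (1 - δ / 2) ≤
              ((diagMeasure ℓ m).prod (phaseMeasure ℓ m))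
                {p | ∀ x ∈ W, ∀ y ∈ W,
                  (1 / ((m : ℝ) * 2 ^ ℓ)) *
                      |∑ j, ∑ k, Real.cos (rht ℓ m p.1 (x + y) j k + 2 * p.2 j k)| ≤ ε / 8} := by
  refine ⟨4096, by norm_num, 1, one_pos, ?_⟩
  intro ℓ ε δ hε hδ W hW m hm
  set R := Metric.diam W
  have hR : 0 ≤ R := Metric.diam_nonneg
  have hd : (1 : ℝ) ≤ 2 ^ ℓ := one_le_pow₀ one_le_two
  obtain ⟨hL4, hLδ⟩ := four_le_and_inv_le hd hR hε hδ
  obtain ⟨hε0, hε1⟩ := hε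
  obtain ⟨hδ0, hδ1⟩ := hδ
  set L : ℝ := 2 ^ ℓ * (1 + R) / (ε * δ) with hL_def
  have hlog : 0 < Real.log L := Real.log_pos (by linarith)
  have hm_log : 4096 * Real.log L ≤ m * ε ^ 2 := by
    have h1 : 4096 * ε⁻¹ ^ 2 * 1 * Real.log L ≤ m := by
      refine le_trans ?_ hm
      rw [pow_one]
      gcongr
      exact one_le_pow₀ (by linarith)
    calc 4096 * Real.log L = (4096 * ε⁻¹ ^ 2 * 1 * Real.log L) * ε ^ 2 := by field_simp
      _ ≤ m * ε ^ 2 := by gcongr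
  have hm0 : 0 < m := by
    rcases Nat.eq_zero_or_pos m with h | h
    · rw [h, Nat.cast_zero, zero_mul] at hm_log
      linarith
    · exact h
  have hm0' : (0 : ℝ) < m := by exact_mod_cast hm0
  refine ofReal_one_sub_le_of_compl_le (by linarith) ?_
  rcases W.eq_empty_or_nonempty with rfl | ⟨x₀, hx₀⟩
  · simp
  set η : ℝ := ε * δ / (64 * 2 ^ ℓ) with hη_def
  have hη : 0 < η := by positivity
  obtain ⟨N, hNcard, hN⟩ := exists_grid (x₀ + x₀) (r := 2 * R) (by positivity) hη
  set t : ℝ := m * 2 ^ ℓ * (ε / 16) with ht_def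
  have ht : 0 ≤ t := by positivity
  have hgrid : {p | ∀ x ∈ W, ∀ y ∈ W, (1 / ((m : ℝ) * 2 ^ ℓ)) *
        |∑ j, ∑ k, Real.cos (rht ℓ m p.1 (x + y) j k + 2 * p.2 j k)| ≤ ε / 8}ᶜ ⊆
      (⋃ w ∈ N, {p : (Fin m → Fin (2 ^ ℓ) → ℝ) × (Fin m → Fin (2 ^ ℓ) → ℝ) |
        t ≤ |∑ j, ∑ k, Real.cos (rht ℓ m p.1 w j k + 2 * p.2 j k)|}) ∪
      {D | 4 * (m * 2 ^ ℓ) / δ ≤ ∑ j, ∑ i, |D j i|} ×ˢ Set.univ := by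
    rw [Set.compl_subset_comm]
    intro p hp x hx y hy
    simp only [Set.mem_compl_iff, Set.mem_union, Set.mem_iUnion, Set.mem_ofPred_eq, Set.mem_prod,
      Set.mem_univ, and_true, not_or, not_exists, not_le] at hp
    obtain ⟨hpN, hpD⟩ := hp
    have hcoord (u : EuclideanSpace ℝ (Fin (2 ^ ℓ))) (hu : u ∈ W) (i : Fin (2 ^ ℓ)) :
        |u i - x₀ i| ≤ R := by
      have h1 := PiLp.norm_apply_le (u - x₀) i
      have h2 := Metric.dist_le_diam_of_mem hW hu hx₀
      rw [dist_eq_norm] at h2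
      simpa using h1.trans h2
    obtain ⟨w, hwN, hw⟩ := hN (x + y) fun i => by
      have h1 := abs_add_le (x i - x₀ i) (y i - x₀ i)
      have h2 := hcoord x hx i
      have h3 := hcoord y hy i
      have h4 : (x + y) i - (x₀ + x₀) i = (x i - x₀ i) + (y i - x₀ i) := by
        simp only [PiLp.add_apply]
        ring
      rw [h4]
      linarith
    have hsum := abs_sum_cos_rht_le ℓ m p.1 p.2 hw
    have hpw := hpN w hwN
    have hrem : 2 ^ ℓ * (η * ∑ j, ∑ i, |p.1 j i|) ≤ t := by
      calc 2 ^ ℓ * (η * ∑ j, ∑ i, |p.1 j i|) ≤ 2 ^ ℓ * (η * (4 * (m * 2 ^ ℓ) / δ)) := by gcongr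
        _ = t := by
          rw [hη_def, ht_def]
          field_simp
          norm_num
    rw [one_div_mul_eq_div, div_le_iff₀ (by positivity)]
    have : ε / 8 * (m * 2 ^ ℓ) = t + t := by
      rw [ht_def]
      ring
    rw [this]
    exact hsum.trans (add_le_add hpw.le hrem)
  have hexp : -t ^ 2 / (2 * (m * 2 ^ ℓ)) = -(m * ε ^ 2 * 2 ^ ℓ / 512) := by
    rw [ht_def]
    field_simp
    norm_num
  have hunion : ((diagMeasure ℓ m).prod (phaseMeasure ℓ m))
      (⋃ w ∈ N, {p | t ≤ |∑ j, ∑ k, Real.cos (rht ℓ m p.1 w j k + 2 * p.2 j k)|}) ≤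
      ENNReal.ofReal (δ / 4) := by
    refine (measure_biUnion_finset_le N _).trans ?_
    refine (Finset.sum_le_card_nsmul N _ _ fun w _ =>
      prod_abs_sum_cos_rht_ge_le ℓ m w ht).trans ?_
    rw [← ENNReal.ofReal_nsmul]
    refine ENNReal.ofReal_le_ofReal ?_
    rw [nsmul_eq_mul, hexp]
    refine (mul_le_mul_of_nonneg_right hNcard (by positivity)).trans ?_
    refine pow_mul_exp_le (by positivity) hL4 (by positivity) ?_ hδ0 hLδ ?_
    · have hquot : 2 * (2 * R / η) = 256 * (2 ^ ℓ * R / (ε * δ)) := by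
        rw [hη_def]
        field_simp
        ring
      have hL_split : L = 2 ^ ℓ * R / (ε * δ) + 2 ^ ℓ / (ε * δ) := by
        rw [hL_def]
        ring
      have hone : 1 ≤ 2 ^ ℓ / (ε * δ) := by
        rw [one_le_div (by positivity)]
        nlinarith
      rw [hquot, hL_split]
      linarith
    · push_cast
      have := mul_le_mul_of_nonneg_right hm_log (by positivity : (0 : ℝ) ≤ 2 ^ ℓ)
      linarith
  refine (measure_mono hgrid).trans ((measure_union_le _ _).trans ?_)
  have hdiag : ((diagMeasure ℓ m).prod (phaseMeasure ℓ m))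
      ({D | 4 * (m * 2 ^ ℓ) / δ ≤ ∑ j, ∑ i, |D j i|} ×ˢ Set.univ) ≤ ENNReal.ofReal (δ / 4) := by
    rw [Measure.prod_prod, measure_univ, mul_one]
    exact diagMeasure_sum_abs_ge_le ℓ m hm0 hδ0
  refine (add_le_add hunion hdiag).trans (le_of_eq ?_)
  rw [← ENNReal.ofReal_add (by positivity) (by positivity)]
  congr 1
  ring
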